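/- Let A be an exact category. The images in the homotopy category H^b(A) of bounded complexes of the strictly acyclic complexes (complexes N with conflations Z^p ⟶ N^p ⟶ Z^{p+1} such that d^p factors as the composite of the deflation followed by the inflation) generate a thick subcategory N of H^b(A): N is a triangulated subcategory of H^b(A) closed under retracts (direct summands). -/

import Mathlib

open CategoryTheory CategoryTheory.Limits CategoryTheory.Pretriangulated

universe v u

/-- A Quillen exact structure on an additive category: a class of kernel–cokernel
pairs (conflations), closed under isomorphism, such that the identity of a zero
object is a deflation, deflations are closed under composition, pullbacks of
deflations exist and are deflations, and pushouts of inflations exist and are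
inflations. -/
structure ExactStructure (A : Type u) [Category.{v} A] [Preadditive A] where
  conflation : ∀ {X Y Z : A}, (X ⟶ Y) → (Y ⟶ Z) → Prop
  comp_zero : ∀ {X Y Z : A} (i : X ⟶ Y) (p : Y ⟶ Z), conflation i p → i ≫ p = 0
  isKernel : ∀ {X Y Z : A} (i : X ⟶ Y) (p : Y ⟶ Z), conflation i p →
    ∀ {W : A} (g : W ⟶ Y), g ≫ p = 0 → ∃! g' : W ⟶ X, g' ≫ i = g
  isCokernel : ∀ {X Y Z : A} (i : X ⟶ Y) (p : Y ⟶ Z), conflation i p →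
    ∀ {W : A} (g : Y ⟶ W), i ≫ g = 0 → ∃! g' : Z ⟶ W, p ≫ g' = g
  iso_closed : ∀ {X Y Z X' Y' Z' : A} (i : X ⟶ Y) (p : Y ⟶ Z)
    (i' : X' ⟶ Y') (p' : Y' ⟶ Z') (eX : X ≅ X') (eY : Y ≅ Y') (eZ : Z ≅ Z'),
    i ≫ eY.hom = eX.hom ≫ i' → p ≫ eZ.hom = eY.hom ≫ p' →
    conflation i p → conflation i' p'
  zero_deflation : ∀ Z : A, IsZero Z → ∃ (X : A) (i : X ⟶ Z), conflation i (𝟙 Z)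
  deflation_comp : ∀ {Y Z W : A} (p : Y ⟶ Z) (q : Z ⟶ W),
    (∃ (X : A) (i : X ⟶ Y), conflation i p) →
    (∃ (X : A) (i : X ⟶ Z), conflation i q) →
    ∃ (X : A) (i : X ⟶ Y), conflation i (p ≫ q)
  pullback_deflation : ∀ {Y Z Z' : A} (p : Y ⟶ Z) (f : Z' ⟶ Z),
    (∃ (X : A) (i : X ⟶ Y), conflation i p) →
    ∃ (Y' : A) (f' : Y' ⟶ Y) (p' : Y' ⟶ Z'), IsPullback f' p' p f ∧
      ∃ (X : A) (i : X ⟶ Y'), conflation i p'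
  pushout_inflation : ∀ {X Y X' : A} (i : X ⟶ Y) (f : X ⟶ X'),
    (∃ (Z : A) (p : Y ⟶ Z), conflation i p) →
    ∃ (Y' : A) (f' : Y ⟶ Y') (i' : X' ⟶ Y'), IsPushout i f f' i' ∧
      ∃ (Z : A) (p : Y' ⟶ Z), conflation i' p


variable {A : Type u} [Category.{v} A] [Preadditive A]

/-- A complex is bounded if its components vanish outside a finite range. -/
def IsBoundedComplex (N : CochainComplex A ℤ) : Prop :=
  ∃ a b : ℤ, ∀ p : ℤ, (p < a ∨ b < p) → IsZero (N.X p)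

/-- A complex `N` is strictly acyclic if there are conflations
`Z^p ⟶ N^p ⟶ Z^{p+1}` such that each differential `d^p` factors as the deflation
`N^p ⟶ Z^{p+1}` followed by the inflation `Z^{p+1} ⟶ N^{p+1}`. -/
def StrictlyAcyclic (E : ExactStructure A) (N : CochainComplex A ℤ) : Prop :=
  ∃ (Z : ℤ → A) (i : ∀ p : ℤ, Z p ⟶ N.X p) (q : ∀ p : ℤ, N.X p ⟶ Z (p + 1)),
    (∀ p : ℤ, E.conflation (i p) (q p)) ∧
    (∀ p : ℤ, N.d p (p + 1) = q p ≫ i (p + 1))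

/-- The class of objects of the homotopy category which are isomorphic to the image
of a bounded strictly acyclic complex (the acyclic objects). -/
def acyclicClass [HasZeroObject A] [HasBinaryBiproducts A] (E : ExactStructure A) :
    Set (HomotopyCategory A (ComplexShape.up ℤ)) :=
  {K | ∃ N : CochainComplex A ℤ, IsBoundedComplex N ∧ StrictlyAcyclic E N ∧
    Nonempty (K ≅ (HomotopyCategory.quotient A (ComplexShape.up ℤ)).obj N)}


open scoped ZeroObject

namespace ExactStructure

/-- A morphism is a deflation if it is the second map of a conflation. -/
def IsDeflation (E : ExactStructure A) {Y Z : A} (p : Y ⟶ Z) : Prop :=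
  ∃ (X : A) (i : X ⟶ Y), E.conflation i p

variable {E : ExactStructure A}

lemma IsDeflation.epi {Y Z : A} {p : Y ⟶ Z} (hp : E.IsDeflation p) : Epi p := by
  obtain ⟨X, i, h⟩ := hp
  refine Preadditive.epi_of_cancel_zero _ fun {W} g hg => ?_
  exact (E.isCokernel i p h 0 Limits.comp_zero).unique hg Limits.comp_zero

lemma IsDeflation.comp {Y Z W : A} {p : Y ⟶ Z} {q : Z ⟶ W} (hp : E.IsDeflation p)
    (hq : E.IsDeflation q) : E.IsDeflation (p ≫ q) :=
  E.deflation_comp p q hp hq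

lemma IsDeflation.of_iso {Y Z Y' Z' : A} {p : Y ⟶ Z} (hp : E.IsDeflation p) (p' : Y' ⟶ Z')
    (eY : Y ≅ Y') (eZ : Z ≅ Z') (h : p ≫ eZ.hom = eY.hom ≫ p') : E.IsDeflation p' := by
  obtain ⟨X, i, hi⟩ := hp
  exact ⟨X, i ≫ eY.hom, E.iso_closed i p _ p' (Iso.refl X) eY eZ (by simp) h hi⟩

lemma IsDeflation.of_isPullback {Y Z Y' Z' : A} {p : Y ⟶ Z} (hp : E.IsDeflation p)
    {f' : Y' ⟶ Y} {p' : Y' ⟶ Z'} {f : Z' ⟶ Z} (sq : IsPullback f' p' p f) :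
    E.IsDeflation p' := by
  obtain ⟨Y'', f'', p'', sq'', h⟩ := E.pullback_deflation p f hp
  exact IsDeflation.of_iso h p' (sq''.isoIsPullback _ _ sq) (Iso.refl _) (by simp)

/-- A complex is locally exact if every cycle becomes a boundary after composition with a
deflation. -/
def LocallyExact (E : ExactStructure A) (K : CochainComplex A ℤ) : Prop :=
  ∀ ⦃i j k : ℤ⦄, i + 1 = j → j + 1 = k → ∀ ⦃U : A⦄ (f : U ⟶ K.X j), f ≫ K.d j k = 0 →
    ∃ (V : A) (p : V ⟶ U) (g : V ⟶ K.X i), E.IsDeflation p ∧ g ≫ K.d i j = p ≫ f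

lemma locallyExact_of_strictlyAcyclic {N : CochainComplex A ℤ} (hN : StrictlyAcyclic E N) :
    E.LocallyExact N := by
  obtain ⟨Z, ι, q, hc, hd⟩ := hN
  rintro i j k rfl rfl U f hf
  have hf' : f ≫ q (i + 1) = 0 := by
    rw [hd] at hf
    exact (E.isKernel _ _ (hc (i + 1 + 1)) 0 zero_comp).unique (by simpa using hf) (by simp)
  obtain ⟨f', hf', -⟩ := E.isKernel _ _ (hc (i + 1)) f hf'
  obtain ⟨V, g, p, sq, hp⟩ := E.pullback_deflation (q i) f' ⟨_, _, hc i⟩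
  exact ⟨V, p, g, hp, by rw [hd, reassoc_of% sq.w, hf']⟩

lemma LocallyExact.of_retract {K L : CochainComplex A ℤ} (hK : E.LocallyExact K)
    (s : L ⟶ K) (r : K ⟶ L) (h : Homotopy (𝟙 L) (s ≫ r)) : E.LocallyExact L := by
  intro i j k hij hjk U f hf
  obtain ⟨V, p, g, hp, hg⟩ := hK hij hjk (f ≫ s.f j) (by simp [reassoc_of% hf])
  refine ⟨V, p, g ≫ r.f i + p ≫ f ≫ h.hom j i, hp, ?_⟩
  have hc := h.comm j
  rw [dNext_eq _ hjk, prevD_eq _ hij] at hc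
  have : f = f ≫ h.hom j i ≫ L.d i j + f ≫ s.f j ≫ r.f j := by
    conv_lhs => rw [← Category.comp_id f, ← HomologicalComplex.id_f, hc]
    simp [reassoc_of% hf]
  conv_rhs => rw [this]
  simp [reassoc_of% hg, add_comm]

lemma LocallyExact.shift {K : CochainComplex A ℤ} (hK : E.LocallyExact K) (n : ℤ) :
    E.LocallyExact (K⟦n⟧) := by
  intro i j k hij hjk U (f : U ⟶ K.X (j + n)) hf
  replace hf : f ≫ (n.negOnePow • K.d (j + n) (k + n)) = 0 := hf
  rw [Linear.comp_units_smul, smul_eq_zero_iff_eq] at hf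
  obtain ⟨V, p, g, hp, hg⟩ := hK (i := i + n) (by lia) (by lia) f hf
  refine ⟨V, p, n.negOnePow • g, hp, ?_⟩
  change (n.negOnePow • g) ≫ (n.negOnePow • K.d (i + n) (j + n)) = p ≫ f
  rw [Linear.comp_units_smul, Linear.units_smul_comp, smul_smul, Int.units_mul_self, one_smul, hg]

lemma LocallyExact.mappingCone [HasBinaryBiproducts A] {K L : CochainComplex A ℤ}
    (hK : E.LocallyExact K) (hL : E.LocallyExact L) (φ : K ⟶ L) :
    E.LocallyExact (CochainComplex.mappingCone φ) := by
  open CochainComplex.mappingCone in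
  intro i j k hij hjk U f hf
  have h1 : (f ≫ (fst φ).1.v j k hjk) ≫ K.d k (k + 1) = 0 := by
    have := d_fst_v φ j k (k + 1) hjk rfl
    have h := hf =≫ (fst φ).1.v k (k + 1) rfl
    rw [Category.assoc, this] at h
    simpa using h
  obtain ⟨V, p, g, hp, hg⟩ := hK hjk rfl _ h1
  have h2 : (p ≫ f ≫ (snd φ).v j j (add_zero j) + g ≫ φ.f j) ≫ L.d j k = 0 := by
    have h := hf =≫ (snd φ).v k k (add_zero k)
    rw [Category.assoc, d_snd_v φ j k hjk] at h
    have h' := p ≫= h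
    simp only [Preadditive.comp_add, zero_comp, Limits.comp_zero] at h'
    rw [← h']
    simp [reassoc_of% hg, add_comm]
  obtain ⟨V', p', g', hp', hg'⟩ := hL hij hjk _ h2
  refine ⟨V', p' ≫ p, -(p' ≫ g ≫ (inl φ).v j i (by lia)) + g' ≫ (inr φ).f i, hp'.comp hp, ?_⟩
  rw [Preadditive.add_comp, Preadditive.neg_comp, Category.assoc, Category.assoc, Category.assoc,
    inl_v_d φ j i k (by lia) (by lia), inr_f_d, reassoc_of% hg']
  apply ext_to φ j k hjk <;> simp [hg]

variable [HasZeroObject A]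

lemma isDeflation_of_isIso {X Y : A} (f : X ⟶ Y) [IsIso f] : E.IsDeflation f := by
  have h : E.IsDeflation (𝟙 (0 : A)) := E.zero_deflation _ (isZero_zero A)
  refine h.of_isPullback (f' := 0) (f := 0) ?_
  exact IsPullback.of_vert_isIso ⟨by simp⟩

lemma isDeflation_of_isZero {X Y : A} (f : X ⟶ Y) (hY : IsZero Y) : E.IsDeflation f := by
  obtain ⟨K, i, hi⟩ := E.zero_deflation _ (isZero_zero A)
  obtain ⟨Y', f', i', sq, Z, p, hp⟩ := E.pushout_inflation i (0 : K ⟶ X) ⟨_, _, hi⟩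
  have hK : IsZero K := by
    rw [IsZero.iff_id_eq_zero]
    exact (E.isKernel i _ hi 0 zero_comp).unique ((isZero_zero A).eq_of_tgt _ _)
      ((isZero_zero A).eq_of_tgt _ _)
  have : IsIso i := ⟨0, hK.eq_of_src _ _, (isZero_zero A).eq_of_src _ _⟩
  have hi' : IsIso i' := sq.isIso_inr_of_isIso
  have hZ : IsZero Z := by
    rw [IsZero.iff_id_eq_zero]
    have h0 := E.comp_zero _ _ hp
    have hp0 : p = 0 := by rw [← cancel_epi i', h0, Limits.comp_zero]
    exact (E.isCokernel _ _ hp 0 Limits.comp_zero).unique (by simp [hp0]) (by simp)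
  exact IsDeflation.of_iso ⟨_, _, hp⟩ f (asIso i').symm (hZ.iso hY) (hY.eq_of_tgt _ _)

variable [HasBinaryBiproducts A]

lemma isDeflation_snd (X Z : A) : E.IsDeflation (biprod.snd : X ⊞ Z ⟶ Z) :=
  (isDeflation_of_isZero (0 : X ⟶ (0 : A)) (isZero_zero A)).of_isPullback
    (IsPullback.of_has_biproduct X Z)

lemma IsDeflation.desc {X W Z : A} {π : W ⟶ Z} (hπ : E.IsDeflation π) (t : X ⟶ Z) :
    E.IsDeflation (biprod.desc t π) := by
  have h1 : E.IsDeflation (biprod.map (𝟙 X) π) := by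
    refine hπ.of_isPullback (f' := biprod.snd) (f := biprod.snd) ?_
    refine IsPullback.of_isLimit' ⟨by simp⟩ (PullbackCone.IsLimit.mk _
      (fun s => biprod.lift (s.snd ≫ biprod.fst) s.fst) (by simp) ?_ ?_)
    · intro s
      apply biprod.hom_ext <;> simp [s.condition]
    · intro s m h1 h2
      apply biprod.hom_ext
      · simp [← h2]
      · simpa using h1
  have h2 : E.IsDeflation (biprod.desc t (𝟙 Z)) :=
    (isDeflation_snd X Z).of_iso _
      (⟨biprod.lift biprod.fst (biprod.snd - biprod.fst ≫ t),
        biprod.lift biprod.fst (biprod.snd + biprod.fst ≫ t), by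
          apply biprod.hom_ext <;> simp, by apply biprod.hom_ext <;> simp⟩ : X ⊞ Z ≅ X ⊞ Z)
      (Iso.refl Z) (by simp [biprod.lift_desc])
  have : biprod.desc t π = biprod.map (𝟙 X) π ≫ biprod.desc t (𝟙 Z) := by
    apply biprod.hom_ext' <;> simp
  rw [this]
  exact h1.comp h2

/-- If a deflation factors through `t`, then `t` becomes a deflation after adding its source
as a summand on which the map vanishes. -/
lemma IsDeflation.fst_comp {X W Z : A} {π : W ⟶ Z} (hπ : E.IsDeflation π) (t : X ⟶ Z)
    (g : W ⟶ X) (hg : g ≫ t = π) : E.IsDeflation ((biprod.fst : X ⊞ W ⟶ X) ≫ t) :=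
  (hπ.desc t).of_iso _
    (⟨biprod.lift (biprod.fst + biprod.snd ≫ g) biprod.snd,
      biprod.lift (biprod.fst - biprod.snd ≫ g) biprod.snd, by
        apply biprod.hom_ext <;> simp, by apply biprod.hom_ext <;> simp⟩ : X ⊞ W ≅ X ⊞ W)
    (Iso.refl Z) (by apply biprod.hom_ext' <;> simp [hg])

end ExactStructure


namespace CochainComplex

/-- An endomorphism of a complex which splits in each degree splits as a morphism of
complexes. -/
lemma exists_splitting {M : CochainComplex A ℤ} (π : M ⟶ M)
    (H : ∀ p, ∃ (N : A) (f : N ⟶ M.X p) (g : M.X p ⟶ N), f ≫ g = 𝟙 N ∧ g ≫ f = π.f p) :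
    ∃ (N : CochainComplex A ℤ) (f : N ⟶ M) (g : M ⟶ N), f ≫ g = 𝟙 N ∧ g ≫ f = π := by
  choose N f g hfg hgf using H
  have hf : ∀ p, f p ≫ π.f p = f p := fun p => by rw [← hgf, reassoc_of% hfg]
  have hg : ∀ p, π.f p ≫ g p = g p := fun p => by
    rw [← hgf, Category.assoc, hfg, Category.comp_id]
  let P : CochainComplex A ℤ :=
    { X := N
      d i j := f i ≫ M.d i j ≫ g j
      shape i j hij := by simp [M.shape i j hij]
      d_comp_d' i j k _ _ := by
        simp only [Category.assoc, reassoc_of% hgf j, π.comm_assoc]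
        simp }
  refine ⟨P, { f := f, comm' := fun i j _ => ?_ }, { f := g, comm' := fun i j _ => ?_ }, ?_, ?_⟩
  · change f i ≫ M.d i j = (f i ≫ M.d i j ≫ g j) ≫ f j
    simp only [Category.assoc, hgf, ← π.comm, reassoc_of% hf]
  · change g i ≫ f i ≫ M.d i j ≫ g j = M.d i j ≫ g j
    rw [reassoc_of% hgf, π.comm_assoc, hg]
  · ext p
    exact hfg p
  · ext p
    exact hgf p

/-- A complex is homotopy bounded if its identity is homotopic to an endomorphism vanishing
outside of a finite range. -/
def HomotopyBounded (L : CochainComplex A ℤ) : Prop :=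
  ∃ (a b : ℤ) (ρ : L ⟶ L), (∀ p, p < a ∨ b < p → ρ.f p = 0) ∧ Nonempty (Homotopy (𝟙 L) ρ)

lemma HomotopyBounded.of_retract {K L : CochainComplex A ℤ} (hK : HomotopyBounded K)
    (s : L ⟶ K) (r : K ⟶ L) (h : Homotopy (𝟙 L) (s ≫ r)) : HomotopyBounded L := by
  obtain ⟨a, b, ρ, hρ, ⟨H⟩⟩ := hK
  refine ⟨a, b, s ≫ ρ ≫ r, fun p hp => by simp [hρ p hp], ⟨h.trans ?_⟩⟩
  exact (Homotopy.ofEq (by simp)).trans ((H.compRight r).compLeft s)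

lemma homotopyBounded_of_isBoundedComplex {K : CochainComplex A ℤ} (hK : IsBoundedComplex K) :
    HomotopyBounded K := by
  obtain ⟨a, b, h⟩ := hK
  exact ⟨a, b, 𝟙 K, fun p hp => (h p hp).eq_of_src _ _, ⟨Homotopy.refl _⟩⟩

/-- Adding a contractible summand does not change the homotopy type. -/
noncomputable def homotopyEquivBiprod [HasBinaryBiproducts A] (L C : CochainComplex A ℤ)
    (hC : Homotopy (𝟙 C) 0) : HomotopyEquiv L (L ⊞ C) where
  hom := biprod.inl
  inv := biprod.fst
  homotopyHomInvId := Homotopy.ofEq (by simp)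
  homotopyInvHomId :=
    (Homotopy.ofEq (by simp)).trans
      (((Homotopy.refl (biprod.fst ≫ biprod.inl)).add
        ((hC.compRight (biprod.inr : C ⟶ L ⊞ C)).compLeft biprod.snd)).symm.trans
          (Homotopy.ofEq (by simp)))

end CochainComplex

namespace ExactStructure

variable {E : ExactStructure A}

/-- The differential `N.d i j` factors as a deflation followed by a kernel of `N.d j k`. -/
def FactorsAt (E : ExactStructure A) (N : CochainComplex A ℤ) (i j k : ℤ) : Prop :=
  ∃ (Q : A) (q : N.X i ⟶ Q) (m : Q ⟶ N.X j), E.IsDeflation q ∧ N.d i j = q ≫ m ∧ Mono m ∧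
    ∀ ⦃W : A⦄ (g : W ⟶ N.X j), g ≫ N.d j k = 0 → ∃ g' : W ⟶ Q, g' ≫ m = g

lemma strictlyAcyclic_of_factorsAt {N : CochainComplex A ℤ}
    (H : ∀ i j k : ℤ, i + 1 = j → j + 1 = k → E.FactorsAt N i j k) : StrictlyAcyclic E N := by
  choose Q q m hq hd hm hk using fun i => H i (i + 1) (i + 1 + 1) rfl rfl
  choose K κ hκ using hq
  have hκm : ∀ p, Mono (κ p) := fun p => Preadditive.mono_of_cancel_zero _ fun g hg =>
    (E.isKernel _ _ (hκ p) 0 zero_comp).unique hg zero_comp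
  have h1 : ∀ p, ∃ e : Q p ⟶ K (p + 1), e ≫ κ (p + 1) = m p := fun p => by
    have hqe : Epi (q p) := IsDeflation.epi ⟨_, _, hκ p⟩
    refine (E.isKernel _ _ (hκ (p + 1)) (m p) ?_).exists
    rw [← cancel_mono (m (p + 1)), ← cancel_epi (q p)]
    have := N.d_comp_d p (p + 1) (p + 1 + 1)
    rw [hd, hd] at this
    simpa using this
  have h2 : ∀ p, ∃ e : K (p + 1) ⟶ Q p, e ≫ m p = κ (p + 1) := fun p => by
    refine hk p _ ?_
    rw [hd, reassoc_of% (E.comp_zero _ _ (hκ (p + 1))), zero_comp]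
  choose e he using h1
  choose e' he' using h2
  have hee : ∀ p, e p ≫ e' p = 𝟙 _ := fun p => by
    have := hm p
    rw [← cancel_mono (m p), Category.assoc, he', he, Category.id_comp]
  have hee' : ∀ p, e' p ≫ e p = 𝟙 _ := fun p => by
    have := hκm (p + 1)
    rw [← cancel_mono (κ (p + 1)), Category.assoc, he, he', Category.id_comp]
  refine ⟨K, κ, fun p => q p ≫ e p, fun p => ?_, fun p => by rw [hd, Category.assoc, he]⟩
  exact E.iso_closed (κ p) (q p) _ _ (Iso.refl _) (Iso.refl _) ⟨e p, e' p, hee p, hee' p⟩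
    (by simp) (by simp) (hκ p)

end ExactStructure

namespace CochainComplex

lemma isZero_X_of_splitting {M N : CochainComplex A ℤ} {f : N ⟶ M} {g : M ⟶ N}
    (hfg : f ≫ g = 𝟙 N) {p : ℤ} (hp : g.f p ≫ f.f p = 0) : IsZero (N.X p) := by
  have h : f.f p ≫ g.f p = 𝟙 _ := by rw [← HomologicalComplex.comp_f, hfg, HomologicalComplex.id_f]
  rw [IsZero.iff_id_eq_zero, ← Category.id_comp (𝟙 _), ← h, Category.assoc, reassoc_of% hp,
    zero_comp, Limits.comp_zero]

lemma exists_splitting_of_homotopy {M : CochainComplex A ℤ}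
    (h : ∀ i j : ℤ, (ComplexShape.up ℤ).Rel j i → (M.X i ⟶ M.X j))
    (H : ∀ p : ℤ, ∃ (N : A) (f : N ⟶ M.X p) (g : M.X p ⟶ N), f ≫ g = 𝟙 N ∧
      g ≫ f = 𝟙 _ - (M.d p (p + 1) ≫ h (p + 1) p rfl +
        h p (p - 1) (by simp) ≫ M.d (p - 1) p)) :
    ∃ (N : CochainComplex A ℤ) (f : N ⟶ M) (g : M ⟶ N), f ≫ g = 𝟙 N ∧
      (∀ p, g.f p ≫ f.f p = 𝟙 _ - (M.d p (p + 1) ≫ h (p + 1) p rfl +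
        h p (p - 1) (by simp) ≫ M.d (p - 1) p)) ∧ Nonempty (Homotopy (g ≫ f) (𝟙 M)) := by
  have key : ∀ p : ℤ, (𝟙 M - Homotopy.nullHomotopicMap' h).f p =
      𝟙 _ - (M.d p (p + 1) ≫ h (p + 1) p rfl +
        h p (p - 1) (by simp) ≫ M.d (p - 1) p) := fun p => by
    rw [HomologicalComplex.sub_f_apply, HomologicalComplex.id_f,
      Homotopy.nullHomotopicMap'_f (k₂ := p - 1) (k₁ := p) (k₀ := p + 1) (by simp) (by simp)]
  obtain ⟨N, f, g, hfg, hgf⟩ := exists_splitting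
    (𝟙 M - Homotopy.nullHomotopicMap' h)
    (fun p => by rw [key]; exact H p)
  refine ⟨N, f, g, hfg, fun p => ?_, ⟨?_⟩⟩
  · rw [← HomologicalComplex.comp_f, hgf, key]
  · refine (Homotopy.ofEq hgf).trans (Homotopy.symm (Homotopy.equivSubZero.symm ?_))
    exact (Homotopy.ofEq (by simp)).trans (Homotopy.nullHomotopy' h)

/-- The terms of a homotopy from the identity to an endomorphism that vanishes in degree `p`. -/
lemma id_eq_of_homotopy {L : CochainComplex A ℤ} {ρ : L ⟶ L} (h : Homotopy (𝟙 L) ρ) {i j k : ℤ}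
    (hij : i + 1 = j) (hjk : j + 1 = k) (hj : ρ.f j = 0) :
    L.d j k ≫ h.hom k j + h.hom j i ≫ L.d i j = 𝟙 _ := by
  have := h.comm j
  rw [dNext_eq _ hjk, prevD_eq _ hij, hj, add_zero] at this
  exact this.symm

/-- The differentials of the periodic complex attached to an idempotent. -/
def periodicD {X : A} (e : X ⟶ X) (n p : ℤ) : X ⟶ X :=
  if Even (p - n) then e else 𝟙 X - e

lemma periodicD_self {X : A} (e : X ⟶ X) (n : ℤ) : periodicD e n n = e := by
  simp [periodicD]

lemma periodicD_add {X : A} (e : X ⟶ X) (n p : ℤ) :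
    periodicD e n p + periodicD e n (p + 1) = 𝟙 X := by
  have : p + 1 - n = (p - n) + 1 := by lia
  by_cases h : Even (p - n)
  · simp [periodicD, this, h, Int.not_odd_iff_even.2 h]
  · simp [periodicD, this, h, Int.not_even_iff_odd.1 h]

lemma periodicD_comp_self {X : A} {e : X ⟶ X} (he : e ≫ e = e) (n p : ℤ) :
    periodicD e n p ≫ periodicD e n p = periodicD e n p := by
  unfold periodicD
  split_ifs <;> simp [he]

lemma periodicD_comp {X : A} {e : X ⟶ X} (he : e ≫ e = e) (n p : ℤ) :
    periodicD e n p ≫ periodicD e n (p + 1) = 0 := by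
  rw [← sub_eq_of_eq_add' (periodicD_add e n p).symm, Preadditive.comp_sub,
    periodicD_comp_self he, Category.comp_id, sub_self]

/-- An idempotent occurs as the first term of a contraction of a complex: take the periodic
complex with differentials `e` and `𝟙 - e`. -/
lemma exists_contractible_of_idem {X : A} (e : X ⟶ X) (he : e ≫ e = e) (n : ℤ) :
    ∃ (C : CochainComplex A ℤ) (k : Homotopy (𝟙 C) 0) (u : X ⟶ C.X n) (v : C.X n ⟶ X),
      u ≫ v = 𝟙 X ∧ v ≫ u = 𝟙 _ ∧ C.d n (n + 1) ≫ k.hom (n + 1) n = v ≫ e ≫ u := by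
  let C : CochainComplex A ℤ :=
    { X := fun _ => X
      d := fun i j => if i + 1 = j then periodicD e n i else 0
      shape := fun i j hij => if_neg hij
      d_comp_d' := by
        rintro i _ _ rfl rfl
        simp [periodicD_comp he] }
  let k : Homotopy (𝟙 C) 0 :=
    { hom := fun i j => if j + 1 = i then periodicD e n j else 0
      zero := fun i j hij => if_neg hij
      comm := fun i => by
        rw [dNext_eq _ (show (ComplexShape.up ℤ).Rel i (i + 1) from rfl),
          prevD_eq _ (show (ComplexShape.up ℤ).Rel (i - 1) i by simp)]
        have := periodicD_add e n (i - 1)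
        simp only [sub_add_cancel] at this
        change 𝟙 X = (if i + 1 = i + 1 then periodicD e n i else 0) ≫
          (if i + 1 = i + 1 then periodicD e n i else 0) +
          (if i - 1 + 1 = i then periodicD e n (i - 1) else 0) ≫
          (if i - 1 + 1 = i then periodicD e n (i - 1) else 0) + 0
        rw [if_pos rfl, if_pos (by lia), periodicD_comp_self he, periodicD_comp_self he, ← this,
          add_zero, add_comm] }
  refine ⟨C, k, 𝟙 X, 𝟙 X, Category.id_comp _, Category.id_comp _, ?_⟩
  change (if n + 1 = n + 1 then periodicD e n n else 0) ≫
    (if n + 1 = n + 1 then periodicD e n n else 0) = 𝟙 X ≫ e ≫ 𝟙 X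
  rw [if_pos rfl, periodicD_self, he, Category.id_comp, Category.comp_id]

lemma HomotopyBounded.exists_boundedAbove [HasZeroObject A] [HasBinaryBiproducts A]
    {L : CochainComplex A ℤ} (hL : HomotopyBounded L) :
    ∃ (N : CochainComplex A ℤ) (b : ℤ), (∀ p, b < p → IsZero (N.X p)) ∧
      Nonempty (HomotopyEquiv L N) := by
  obtain ⟨a, b, ρ, hρ, ⟨h⟩⟩ := hL
  obtain ⟨n, rfl⟩ : ∃ n, b = n - 1 := ⟨b + 1, by lia⟩
  have rel : ∀ i j k : ℤ, i + 1 = j → j + 1 = k → n ≤ j →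
      L.d j k ≫ h.hom k j + h.hom j i ≫ L.d i j = 𝟙 _ := fun i j k hij hjk hj =>
    id_eq_of_homotopy h hij hjk (hρ _ (Or.inr (by lia)))
  obtain ⟨e, he⟩ : ∃ e, e = h.hom n (n - 1) ≫ L.d (n - 1) n := ⟨_, rfl⟩
  have he' : L.d n (n + 1) ≫ h.hom (n + 1) n = 𝟙 _ - e := by
    rw [he, ← rel (n - 1) n (n + 1) (by lia) rfl le_rfl]
    simp
  have hee : e ≫ e = e := by
    have : e ≫ (𝟙 _ - e) = 0 := by rw [← he', he]; simp
    rw [Preadditive.comp_sub, Category.comp_id, sub_eq_zero] at this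
    exact this.symm
  obtain ⟨C, k, u, v, huv, hvu, hC⟩ := exists_contractible_of_idem e hee n
  have relC : ∀ i j l : ℤ, i + 1 = j → j + 1 = l →
      C.d j l ≫ k.hom l j + k.hom j i ≫ C.d i j = 𝟙 _ :=
    fun i j l hij hjl => id_eq_of_homotopy k hij hjl rfl
  let s : ∀ i j : ℤ, (ComplexShape.up ℤ).Rel j i → ((L ⊞ C).X i ⟶ (L ⊞ C).X j) :=
    fun i j _ => if n + 1 ≤ i then
      (biprod.fst : L ⊞ C ⟶ L).f i ≫ h.hom i j ≫ (biprod.inl : L ⟶ L ⊞ C).f j +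
      (biprod.snd : L ⊞ C ⟶ C).f i ≫ k.hom i j ≫ (biprod.inr : C ⟶ L ⊞ C).f j else 0
  have hs : ∀ p, n < p → 𝟙 _ - ((L ⊞ C).d p (p + 1) ≫ s (p + 1) p rfl +
        s p (p - 1) (by simp) ≫ (L ⊞ C).d (p - 1) p) = 0 := fun p hp => by
    dsimp only [s]
    rw [if_pos (by lia), if_pos (by lia)]
    have h1 := rel (p - 1) p (p + 1) (by lia) rfl (by lia)
    have h2 := relC (p - 1) p (p + 1) (by lia) rfl
    apply HomologicalComplex.biprodX_ext_from <;>
    apply HomologicalComplex.biprodX_ext_to <;>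
    simp [h1, h2]
  obtain ⟨N, f, g, hfg, hgf, ⟨H⟩⟩ := exists_splitting_of_homotopy s (by
      intro p
      rcases lt_trichotomy p n with hp | rfl | hp
      · refine ⟨_, 𝟙 _, 𝟙 _, by simp, ?_⟩
        dsimp only [s]
        rw [if_neg (by lia), if_neg (by lia)]
        simp
      · refine ⟨L.X p, e ≫ (biprod.inl : L ⟶ L ⊞ C).f p +
            (𝟙 _ - e) ≫ u ≫ (biprod.inr : C ⟶ L ⊞ C).f p,
          (biprod.fst : L ⊞ C ⟶ L).f p ≫ e +
            (biprod.snd : L ⊞ C ⟶ C).f p ≫ v ≫ (𝟙 _ - e), ?_, ?_⟩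
        · simp [hee, huv, reassoc_of% huv]
        · dsimp only [s]
          rw [if_pos (by lia), if_neg (by lia)]
          apply HomologicalComplex.biprodX_ext_from <;>
          apply HomologicalComplex.biprodX_ext_to <;>
          simp [reassoc_of% hee, he', hC, reassoc_of% hvu]
      · exact ⟨0, 0, 0, (isZero_zero A).eq_of_src _ _, by rw [hs p hp, zero_comp]⟩)
  exact ⟨N, n, fun p hp => isZero_X_of_splitting hfg ((hgf p).trans (hs p hp)),
    ⟨(homotopyEquivBiprod L C k).trans ⟨g, f, H, Homotopy.ofEq hfg⟩⟩⟩

end CochainComplex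

namespace ExactStructure

variable {E : ExactStructure A}

lemma exists_bounded_strictlyAcyclic [HasZeroObject A] {M : CochainComplex A ℤ}
    (hM : ∀ i j k : ℤ, i + 1 = j → j + 1 = k → E.FactorsAt M i j k)
    (hb : ∃ b : ℤ, ∀ p, b < p → IsZero (M.X p)) (hM' : CochainComplex.HomotopyBounded M) :
    ∃ N : CochainComplex A ℤ, IsBoundedComplex N ∧ StrictlyAcyclic E N ∧
      Nonempty (HomotopyEquiv M N) := by
  obtain ⟨b, hb⟩ := hb
  obtain ⟨a, b', ρ, hρ, ⟨h⟩⟩ := hM'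
  obtain ⟨c, rfl⟩ : ∃ c, a = c + 2 := ⟨a - 2, by lia⟩
  have rel : ∀ i j k : ℤ, i + 1 = j → j + 1 = k → j ≤ c + 1 →
      M.d j k ≫ h.hom k j + h.hom j i ≫ M.d i j = 𝟙 _ := fun i j k hij hjk hj =>
    CochainComplex.id_eq_of_homotopy h hij hjk (hρ _ (Or.inl (by lia)))
  let s : ∀ i j : ℤ, (ComplexShape.up ℤ).Rel j i → (M.X i ⟶ M.X j) :=
    fun i j _ => if i ≤ c then h.hom i j else 0
  have hs_lt : ∀ p, p < c → 𝟙 _ - (M.d p (p + 1) ≫ s (p + 1) p rfl +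
      s p (p - 1) (by simp) ≫ M.d (p - 1) p) = 0 := fun p hp => by
    dsimp only [s]
    rw [if_pos (by lia), if_pos (by lia), rel _ _ _ (by lia) rfl (by lia), sub_self]
  have hs_eq : 𝟙 _ - (M.d c (c + 1) ≫ s (c + 1) c rfl +
      s c (c - 1) (by simp) ≫ M.d (c - 1) c) = M.d c (c + 1) ≫ h.hom (c + 1) c := by
    dsimp only [s]
    rw [if_neg (by lia), if_pos (by lia), ← rel (c - 1) c (c + 1) (by lia) rfl (by lia)]
    simp
  have hs_gt : ∀ p, c < p → 𝟙 _ - (M.d p (p + 1) ≫ s (p + 1) p rfl +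
      s p (p - 1) (by simp) ≫ M.d (p - 1) p) = 𝟙 _ := fun p hp => by
    dsimp only [s]
    rw [if_neg (by lia), if_neg (by lia)]
    simp
  obtain ⟨N, f, g, hfg, hgf, ⟨H⟩⟩ := CochainComplex.exists_splitting_of_homotopy s (by
    intro p
    rcases lt_trichotomy p c with hp | rfl | hp
    · exact ⟨0, 0, 0, (isZero_zero A).eq_of_src _ _, by rw [hs_lt p hp, zero_comp]⟩
    · obtain ⟨Q, q, m, hq, hd, hm, -⟩ := hM p (p + 1) (p + 1 + 1) rfl rfl
      have := hq.epi
      refine ⟨Q, m ≫ h.hom (p + 1) p, q, ?_, by rw [hs_eq, hd, Category.assoc]⟩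
      have hmd : m ≫ M.d (p + 1) (p + 1 + 1) = 0 := by
        rw [← cancel_epi q, ← Category.assoc, ← hd]
        simp
      rw [← cancel_mono m, Category.assoc, Category.assoc, ← hd,
        ← sub_eq_of_eq_add' (rel p (p + 1) (p + 1 + 1) rfl rfl le_rfl).symm]
      simp [reassoc_of% hmd]
    · exact ⟨_, 𝟙 _, 𝟙 _, by simp, by rw [hs_gt p hp, Category.comp_id]⟩)
  have hfg' : ∀ p, f.f p ≫ g.f p = 𝟙 _ := fun p => by
    rw [← HomologicalComplex.comp_f, hfg, HomologicalComplex.id_f]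
  have hlt : ∀ p, p < c → IsZero (N.X p) := fun p hp =>
    CochainComplex.isZero_X_of_splitting hfg ((hgf p).trans (hs_lt p hp))
  refine ⟨N, ⟨c, b, ?_⟩, strictlyAcyclic_of_factorsAt ?_, ⟨⟨g, f, H, Homotopy.ofEq hfg⟩⟩⟩
  · rintro p (hp | hp)
    · exact hlt p hp
    · exact CochainComplex.isZero_X_of_splitting hfg ((hb p hp).eq_of_src _ _)
  · intro i j k hij hjk
    rcases le_or_gt i c with hi | hi
    · refine ⟨N.X i, 𝟙 _, N.d i j, isDeflation_of_isIso _, by simp, ?_, fun W w hw => ?_⟩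
      · rcases hi.lt_or_eq with hi | rfl
        · exact ⟨fun _ _ _ => (hlt i hi).eq_of_tgt _ _⟩
        · refine Preadditive.mono_of_cancel_zero _ fun {W} x hx => ?_
          obtain rfl := hij
          have hxf : x ≫ f.f i = 0 := by
            rw [← Category.id_comp (f.f i), ← hfg', Category.assoc, (hgf i).trans hs_eq,
              f.comm_assoc, reassoc_of% hx, zero_comp]
          rw [← Category.comp_id x, ← hfg', reassoc_of% hxf, zero_comp]
      · refine ⟨w ≫ f.f j ≫ h.hom j i ≫ g.f i, ?_⟩
        have := w ≫= f.f j ≫= rel i j k hij hjk (by lia) =≫ g.f j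
        simp only [Preadditive.comp_add, Preadditive.add_comp, Category.assoc, f.comm_assoc,
          reassoc_of% hw, zero_comp, zero_add, Category.id_comp, hfg', Category.comp_id] at this
        simpa using this
    · have hgf' : ∀ p, c < p → g.f p ≫ f.f p = 𝟙 _ := fun p hp => (hgf p).trans (hs_gt p hp)
      obtain ⟨Q, q, m, hq, hd, hm, hk⟩ := hM i j k hij hjk
      refine ⟨Q, f.f i ≫ q, m ≫ g.f j, ?_, ?_, ?_, fun W w hw => ?_⟩
      · exact hq.of_iso _ ⟨g.f i, f.f i, hgf' i hi, hfg' i⟩ (Iso.refl _)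
          (by simp [reassoc_of% (hgf' i hi)])
      · rw [← Category.comp_id (N.d i j), ← hfg', ← f.comm_assoc, hd]
        simp
      · have : Mono (g.f j) := ⟨fun x y hxy => by
          simpa [hgf' j (by lia)] using hxy =≫ f.f j⟩
        infer_instance
      · obtain ⟨w', hw'⟩ := hk (w ≫ f.f j) (by simp [reassoc_of% hw])
        exact ⟨w', by rw [reassoc_of% hw', hfg', Category.comp_id]⟩

end ExactStructure

/-- Dependent recursion on the integers, downwards from `b`. -/
noncomputable def Int.downRec {S : ℤ → Type*} {b : ℤ} (s₀ : ∀ p, b < p → S p)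
    (F : ∀ p, p ≤ b → S (p + 1) → S p) (p : ℤ) : S p :=
  if h : b < p then s₀ p h else F p (not_lt.1 h) (Int.downRec s₀ F (p + 1))
termination_by (b + 1 - p).toNat
decreasing_by lia

lemma Int.exists_downRec {S : ℤ → Type*} (R : ∀ p, S p → S (p + 1) → Prop) (b : ℤ)
    (h₀ : ∀ p, b < p → Nonempty (S p)) (h₁ : ∀ p, b < p → ∀ s t, R p s t)
    (h₂ : ∀ p, p ≤ b → ∀ t, ∃ s, R p s t) : ∃ st : ∀ p, S p, ∀ p, R p (st p) (st (p + 1)) := by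
  choose F hF using h₂
  refine ⟨Int.downRec (fun p hp => (h₀ p hp).some) F, fun p => ?_⟩
  by_cases hp : b < p
  · exact h₁ p hp _ _
  · conv => arg 2; rw [Int.downRec, dif_neg hp]
    exact hF p _ _

namespace CochainComplex

lemma exists_contractible_of_family [HasBinaryBiproducts A] (V : ℤ → A) :
    ∃ (C : CochainComplex A ℤ) (_ : Homotopy (𝟙 C) 0) (α : ∀ p, C.X p ≅ V p ⊞ V (p + 1)),
      ∀ p, C.d p (p + 1) ≫ (α (p + 1)).hom = (α p).hom ≫ biprod.snd ≫ biprod.inl := by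
  let C : CochainComplex A ℤ :=
    { X := fun p => V p ⊞ V (p + 1)
      d := fun i j => if h : i + 1 = j then
        biprod.snd ≫ eqToHom (by rw [h]) ≫ biprod.inl else 0
      shape := fun i j hij => dif_neg hij
      d_comp_d' := by
        rintro i _ _ rfl rfl
        simp }
  let σ : ∀ i j, C.X i ⟶ C.X j := fun i j =>
    if h : j + 1 = i then biprod.fst ≫ eqToHom (by rw [h]) ≫ biprod.inr else 0
  have hd : ∀ i, C.d i (i + 1) = biprod.snd ≫ biprod.inl := fun i => by simp [C]
  have hσ : ∀ i, σ (i + 1) i = biprod.fst ≫ biprod.inr := fun i => by simp [σ]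
  let k : Homotopy (𝟙 C) 0 :=
    { hom := σ
      zero := fun i j hij => dif_neg hij
      comm := fun i => by
        obtain ⟨i, rfl⟩ : ∃ j, i = j + 1 := ⟨i - 1, by lia⟩
        rw [dNext_eq _ (show (ComplexShape.up ℤ).Rel (i + 1) (i + 1 + 1) from rfl),
          prevD_eq _ (show (ComplexShape.up ℤ).Rel i (i + 1) from rfl), hd, hd, hσ, hσ]
        change 𝟙 (V (i + 1) ⊞ V (i + 1 + 1)) =
          (biprod.snd ≫ biprod.inl) ≫ biprod.fst ≫ biprod.inr +
          (biprod.fst ≫ biprod.inr) ≫ biprod.snd ≫ biprod.inl + 0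
        apply biprod.hom_ext' <;> apply biprod.hom_ext <;> simp }
  refine ⟨C, k, fun p => Iso.refl (V p ⊞ V (p + 1)), fun p => ?_⟩
  rw [hd]
  exact (Category.comp_id _).trans (Category.id_comp _).symm

end CochainComplex

namespace ExactStructure

variable {E : ExactStructure A}

/-- An object `Z` representing pairs consisting of a cycle of `L` in degree `p` and
of a morphism to `V`, where `V` vanishes in degrees `> b`. -/
structure CycleData (L : CochainComplex A ℤ) (b p : ℤ) where
  V : A
  Z : A
  ι₁ : Z ⟶ L.X p
  ι₂ : Z ⟶ V
  isZero : b < p → IsZero V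
  comp_d : ι₁ ≫ L.d p (p + 1) = 0
  ext_zero : ∀ ⦃W : A⦄ (w : W ⟶ Z), w ≫ ι₁ = 0 → w ≫ ι₂ = 0 → w = 0
  exists_lift : ∀ ⦃W : A⦄ (x : W ⟶ L.X p) (v : W ⟶ V), x ≫ L.d p (p + 1) = 0 →
    ∃ w : W ⟶ Z, w ≫ ι₁ = x ∧ w ≫ ι₂ = v

lemma CycleData.ext_hom {L : CochainComplex A ℤ} {b p : ℤ} (s : CycleData L b p) {W : A}
    {w w' : W ⟶ s.Z} (h₁ : w ≫ s.ι₁ = w' ≫ s.ι₁) (h₂ : w ≫ s.ι₂ = w' ≫ s.ι₂) : w = w' :=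
  sub_eq_zero.1 (s.ext_zero _ (by simp [h₁]) (by simp [h₂]))

variable [HasBinaryBiproducts A]

/-- The map from `L.X p ⊞ (s.V ⊞ t.V)` to `t.Z` induced by the differential and the projection
to `t.V` is a deflation. -/
def CycleData.IsCover (E : ExactStructure A) {L : CochainComplex A ℤ} {b p : ℤ}
    (s : CycleData L b p) (t : CycleData L b (p + 1)) : Prop :=
  ∃ τ : L.X p ⊞ (s.V ⊞ t.V) ⟶ t.Z, E.IsDeflation τ ∧
    τ ≫ t.ι₁ = biprod.fst ≫ L.d p (p + 1) ∧ τ ≫ t.ι₂ = biprod.snd ≫ biprod.snd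

lemma LocallyExact.exists_isCover [HasZeroObject A] {L : CochainComplex A ℤ}
    (hL : E.LocallyExact L) {b p : ℤ} (hp : p ≤ b) (t : CycleData L b (p + 1)) :
    ∃ s : CycleData L b p, s.IsCover E t := by
  obtain ⟨W, π, g, hπ, hg⟩ := hL rfl rfl t.ι₁ t.comp_d
  obtain ⟨T, hT₁, hT₂⟩ := t.exists_lift (biprod.fst ≫ L.d p (p + 1) : L.X p ⊞ t.V ⟶ _)
    biprod.snd (by simp)
  obtain ⟨τ, hτ₁, hτ₂⟩ := t.exists_lift (biprod.fst ≫ L.d p (p + 1) : L.X p ⊞ (W ⊞ t.V) ⟶ _)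
    (biprod.snd ≫ biprod.snd) (by simp)
  have hτ : E.IsDeflation τ := by
    refine (hπ.fst_comp T (biprod.lift g (π ≫ t.ι₂))
      (t.ext_hom (by simp [hT₁, hg]) (by simp [hT₂]))).of_iso τ
      ⟨biprod.lift (biprod.fst ≫ biprod.fst) (biprod.lift biprod.snd (biprod.fst ≫ biprod.snd)),
        biprod.lift (biprod.lift biprod.fst (biprod.snd ≫ biprod.snd)) (biprod.snd ≫ biprod.fst),
        ?_, ?_⟩ (Iso.refl _) (t.ext_hom (by simp [hT₁, hτ₁]) (by simp [hT₂, hτ₂]))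
    · apply biprod.hom_ext
      · apply biprod.hom_ext <;> simp
      · simp
    · apply biprod.hom_ext
      · simp
      · apply biprod.hom_ext <;> simp
  obtain ⟨Z, κ, hκ⟩ := id hτ
  have hκτ : κ ≫ τ = 0 := E.comp_zero _ _ hκ
  have hκ₁ : κ ≫ biprod.fst ≫ L.d p (p + 1) = 0 := by rw [← hτ₁, reassoc_of% hκτ, zero_comp]
  have hκ₂ : κ ≫ biprod.snd ≫ biprod.snd = 0 := by rw [← hτ₂, reassoc_of% hκτ, zero_comp]
  refine ⟨⟨W, Z, κ ≫ biprod.fst, κ ≫ biprod.snd ≫ biprod.fst, by lia, by simpa using hκ₁,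
    fun U w h₁ h₂ => ?_, fun U x v hx => ?_⟩, τ, hτ, hτ₁, hτ₂⟩
  · refine (E.isKernel _ _ hκ 0 zero_comp).unique ?_ zero_comp
    apply biprod.hom_ext
    · simpa using h₁
    · apply biprod.hom_ext
      · simpa using h₂
      · simp [hκ₂]
  · obtain ⟨w, hw, -⟩ := E.isKernel _ _ hκ (biprod.lift x (biprod.lift v 0))
      (t.ext_zero _ (by simp [hτ₁, hx]) (by simp [hτ₂]))
    exact ⟨w, by simp [reassoc_of% hw], by simp [reassoc_of% hw]⟩

lemma LocallyExact.exists_factorsAt [HasZeroObject A] {L : CochainComplex A ℤ}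
    (hL : E.LocallyExact L) {b : ℤ} (hb : ∀ p, b < p → IsZero (L.X p)) :
    ∃ M : CochainComplex A ℤ, (∀ i j k : ℤ, i + 1 = j → j + 1 = k → E.FactorsAt M i j k) ∧
      (∃ b : ℤ, ∀ p, b < p → IsZero (M.X p)) ∧ Nonempty (HomotopyEquiv L M) := by
  obtain ⟨st, hst⟩ := Int.exists_downRec (S := CycleData L b) (fun _ s t => s.IsCover E t) b
    (fun p hp => ⟨⟨0, 0, 0, 0, fun _ => isZero_zero A, zero_comp,
      fun _ _ _ _ => (isZero_zero A).eq_of_tgt _ _,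
      fun _ _ _ _ => ⟨0, (hb p hp).eq_of_tgt _ _, (isZero_zero A).eq_of_tgt _ _⟩⟩⟩)
    (fun p hp s t => by
      have hZ : IsZero t.Z := by
        rw [IsZero.iff_id_eq_zero]
        exact t.ext_zero _ ((hb _ (by lia)).eq_of_tgt _ _) ((t.isZero (by lia)).eq_of_tgt _ _)
      exact ⟨0, isDeflation_of_isZero _ hZ, (hb _ (by lia)).eq_of_tgt _ _,
        (t.isZero (by lia)).eq_of_tgt _ _⟩)
    (fun p hp t => hL.exists_isCover hp t)
  obtain ⟨C, k, α, hα⟩ := CochainComplex.exists_contractible_of_family fun p => (st p).V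
  refine ⟨L ⊞ C, ?_, ⟨b, fun p hp => ?_⟩, ⟨CochainComplex.homotopyEquivBiprod L C k⟩⟩
  · rintro i _ _ rfl rfl
    obtain ⟨τ, hτ, hτ₁, hτ₂⟩ := hst i
    refine ⟨_, (biprod.lift ((biprod.fst : L ⊞ C ⟶ L).f i)
        ((biprod.snd : L ⊞ C ⟶ C).f i ≫ (α i).hom)) ≫ τ,
      (st (i + 1)).ι₁ ≫ (biprod.inl : L ⟶ L ⊞ C).f (i + 1) +
        (st (i + 1)).ι₂ ≫ biprod.inl ≫ (α (i + 1)).inv ≫ (biprod.inr : C ⟶ L ⊞ C).f (i + 1),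
      ?_, ?_, ?_, fun W w hw => ?_⟩
    · let e : L.X i ⊞ ((st i).V ⊞ (st (i + 1)).V) ≅ (L ⊞ C).X i :=
        ⟨biprod.fst ≫ (biprod.inl : L ⟶ L ⊞ C).f i +
          biprod.snd ≫ (α i).inv ≫ (biprod.inr : C ⟶ L ⊞ C).f i,
        biprod.lift ((biprod.fst : L ⊞ C ⟶ L).f i) ((biprod.snd : L ⊞ C ⟶ C).f i ≫ (α i).hom),
        by apply biprod.hom_ext <;> simp, by simp [biprod.lift_eq]⟩
      exact hτ.of_iso _ e (Iso.refl _) ((Category.comp_id τ).trans (e.hom_inv_id_assoc τ).symm)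
    · have hd : C.d i (i + 1) =
          (α i).hom ≫ biprod.snd ≫ biprod.inl ≫ (α (i + 1)).inv := by
        rw [← cancel_mono (α (i + 1)).hom, hα]
        simp
      apply HomologicalComplex.biprodX_ext_to
      · simp [hτ₁]
      · rw [← HomologicalComplex.Hom.comm, hd]
        simp [reassoc_of% hτ₂]
    · refine Preadditive.mono_of_cancel_zero _ fun w hw => ?_
      refine (st (i + 1)).ext_zero w ?_ ?_
      · simpa using hw =≫ (biprod.fst : L ⊞ C ⟶ L).f (i + 1)
      · simpa using hw =≫ ((biprod.snd : L ⊞ C ⟶ C).f (i + 1) ≫ (α (i + 1)).hom ≫ biprod.fst)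
    · obtain ⟨w', h₁, h₂⟩ := (st (i + 1)).exists_lift (w ≫ (biprod.fst : L ⊞ C ⟶ L).f (i + 1))
        (w ≫ (biprod.snd : L ⊞ C ⟶ C).f (i + 1) ≫ (α (i + 1)).hom ≫ biprod.fst)
        (by simpa using hw =≫ (biprod.fst : L ⊞ C ⟶ L).f (i + 1 + 1))
      have hw₂ : w ≫ (biprod.snd : L ⊞ C ⟶ C).f (i + 1) ≫ (α (i + 1)).hom ≫ biprod.snd = 0 := by
        have := hw =≫ ((biprod.snd : L ⊞ C ⟶ C).f (i + 1 + 1) ≫ (α (i + 1 + 1)).hom ≫ biprod.fst)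
        rw [Category.assoc, ← HomologicalComplex.Hom.comm_assoc, reassoc_of% hα] at this
        simpa using this
      refine ⟨w', ?_⟩
      apply HomologicalComplex.biprodX_ext_to
      · simp [h₁]
      · rw [← cancel_mono (α (i + 1)).hom]
        apply biprod.hom_ext <;> simp [reassoc_of% h₂, hw₂]
  · have hC : IsZero (C.X p) := by
      refine IsZero.of_iso ?_ (α p)
      rw [IsZero.iff_id_eq_zero]
      apply biprod.hom_ext'
      · exact ((st p).isZero hp).eq_of_src _ _
      · exact ((st (p + 1)).isZero (by lia)).eq_of_src _ _
    rw [IsZero.iff_id_eq_zero]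
    apply HomologicalComplex.biprodX_ext_from
    · exact (hb p hp).eq_of_src _ _
    · exact hC.eq_of_src _ _

end ExactStructure

namespace ExactStructure

variable {E : ExactStructure A} [HasZeroObject A] [HasBinaryBiproducts A]

/-- A homotopy bounded and locally exact complex is homotopy equivalent to a bounded strictly
acyclic one. -/
lemma LocallyExact.quotient_obj_mem_acyclicClass {L : CochainComplex A ℤ} (hL : E.LocallyExact L)
    (hb : CochainComplex.HomotopyBounded L) :
    (HomotopyCategory.quotient A (ComplexShape.up ℤ)).obj L ∈ acyclicClass E := by
  obtain ⟨L', b, hb', ⟨e⟩⟩ := hb.exists_boundedAbove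
  obtain ⟨M, hM, hMb, ⟨e'⟩⟩ :=
    (hL.of_retract e.inv e.hom e.homotopyInvHomId.symm).exists_factorsAt hb'
  obtain ⟨N, hN, hN', ⟨e''⟩⟩ := exists_bounded_strictlyAcyclic hM hMb
    (hb.of_retract (e.trans e').inv (e.trans e').hom (e.trans e').homotopyInvHomId.symm)
  exact ⟨N, hN, hN', ⟨HomotopyCategory.isoOfHomotopyEquiv ((e.trans e').trans e'')⟩⟩

lemma acyclicClass_of_iso {K L : HomotopyCategory A (ComplexShape.up ℤ)}
    (hK : K ∈ acyclicClass E) (e : K ≅ L) : L ∈ acyclicClass E := by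
  obtain ⟨N, hN, hN', ⟨e'⟩⟩ := hK
  exact ⟨N, hN, hN', ⟨e.symm ≪≫ e'⟩⟩

lemma acyclicClass_of_isZero {K : HomotopyCategory A (ComplexShape.up ℤ)} (hK : IsZero K) :
    K ∈ acyclicClass E := by
  have h0 : ∀ p, IsZero ((0 : CochainComplex A ℤ).X p) := fun p =>
    (HomologicalComplex.eval A (ComplexShape.up ℤ) p).map_isZero (isZero_zero _)
  have h : (HomotopyCategory.quotient A (ComplexShape.up ℤ)).obj 0 ∈ acyclicClass E := by
    refine LocallyExact.quotient_obj_mem_acyclicClass ?_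
      (CochainComplex.homotopyBounded_of_isBoundedComplex ⟨0, 0, fun p _ => h0 p⟩)
    intro i j k _ _ U f _
    exact ⟨U, 𝟙 U, 0, isDeflation_of_isIso _, (h0 j).eq_of_tgt _ _⟩
  exact acyclicClass_of_iso h ((Functor.map_isZero _ (isZero_zero _)).iso hK)

lemma acyclicClass_shift {K : HomotopyCategory A (ComplexShape.up ℤ)}
    (hK : K ∈ acyclicClass E) (n : ℤ) : K⟦n⟧ ∈ acyclicClass E := by
  obtain ⟨N, ⟨a, b, hN⟩, hN', ⟨e⟩⟩ := hK
  have h : (HomotopyCategory.quotient A (ComplexShape.up ℤ)).obj (N⟦n⟧) ∈ acyclicClass E :=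
    ((locallyExact_of_strictlyAcyclic hN').shift n).quotient_obj_mem_acyclicClass
      (CochainComplex.homotopyBounded_of_isBoundedComplex
        ⟨a - n, b - n, fun p hp => hN (p + n) (by lia)⟩)
  exact acyclicClass_of_iso h
    (((HomotopyCategory.quotient A (ComplexShape.up ℤ)).commShiftIso n).app N ≪≫
      (shiftFunctor _ n).mapIso e.symm)

lemma mappingCone_mem_acyclicClass {K L : CochainComplex A ℤ} (hK : IsBoundedComplex K)
    (hK' : StrictlyAcyclic E K) (hL : IsBoundedComplex L) (hL' : StrictlyAcyclic E L) (φ : K ⟶ L) :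
    (HomotopyCategory.quotient A (ComplexShape.up ℤ)).obj (CochainComplex.mappingCone φ) ∈
      acyclicClass E := by
  refine ((locallyExact_of_strictlyAcyclic hK').mappingCone
    (locallyExact_of_strictlyAcyclic hL') φ).quotient_obj_mem_acyclicClass
    (CochainComplex.homotopyBounded_of_isBoundedComplex ?_)
  obtain ⟨a, b, hK⟩ := hK
  obtain ⟨a', b', hL⟩ := hL
  refine ⟨min (a - 1) a', max b b', fun p hp => ?_⟩
  rw [IsZero.iff_id_eq_zero]
  apply CochainComplex.mappingCone.ext_to φ p (p + 1) rfl
  · exact (hK _ (by lia)).eq_of_tgt _ _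
  · exact (hL _ (by lia)).eq_of_tgt _ _

lemma acyclicClass_of_distTriang {D : Triangle (HomotopyCategory A (ComplexShape.up ℤ))}
    (hD : D ∈ distTriang (HomotopyCategory A (ComplexShape.up ℤ)))
    (h₁ : D.obj₁ ∈ acyclicClass E) (h₃ : D.obj₃ ∈ acyclicClass E) : D.obj₂ ∈ acyclicClass E := by
  obtain ⟨N, hN, hN', ⟨e⟩⟩ := acyclicClass_shift h₃ (-1)
  obtain ⟨N₁, hN₁, hN₁', ⟨e₁⟩⟩ := h₁
  obtain ⟨m, hm⟩ : ∃ m : D.obj₃⟦(-1 : ℤ)⟧ ⟶ D.obj₁, m = D.invRotate.mor₁ := ⟨_, rfl⟩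
  obtain ⟨φ, hφ⟩ := (HomotopyCategory.quotient A (ComplexShape.up ℤ)).map_surjective
    (e.inv ≫ m ≫ e₁.hom)
  refine acyclicClass_of_iso (mappingCone_mem_acyclicClass hN hN' hN₁ hN₁' φ) ?_
  exact Triangle.π₃.mapIso (isoTriangleOfIso₁₂ _ _
    (HomotopyCategory.mappingCone_triangleh_distinguished φ)
    (inv_rot_of_distTriang _ hD) e.symm e₁.symm (by
      change (HomotopyCategory.quotient A (ComplexShape.up ℤ)).map φ ≫ e₁.inv = e.inv ≫ _
      rw [hφ, ← hm]
      simp))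

lemma acyclicClass_of_retract {K L : HomotopyCategory A (ComplexShape.up ℤ)}
    (hK : K ∈ acyclicClass E) (s : L ⟶ K) (r : K ⟶ L) (h : s ≫ r = 𝟙 L) :
    L ∈ acyclicClass E := by
  obtain ⟨N, hN, hN', ⟨e⟩⟩ := hK
  obtain ⟨L, rfl⟩ := HomotopyCategory.quotient_obj_surjective L
  obtain ⟨s', hs'⟩ := (HomotopyCategory.quotient A (ComplexShape.up ℤ)).map_surjective (s ≫ e.hom)
  obtain ⟨r', hr'⟩ := (HomotopyCategory.quotient A (ComplexShape.up ℤ)).map_surjective (e.inv ≫ r)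
  have H : Homotopy (𝟙 L) (s' ≫ r') := HomotopyCategory.homotopyOfEq _ _ (by
    rw [Functor.map_comp, hs', hr', CategoryTheory.Functor.map_id]
    simp [h])
  exact ((locallyExact_of_strictlyAcyclic hN').of_retract s' r' H).quotient_obj_mem_acyclicClass
    ((CochainComplex.homotopyBounded_of_isBoundedComplex hN).of_retract s' r' H)

end ExactStructure

/-- The images in the bounded homotopy category of the (strictly) acyclic complexes
form a thick subcategory: the class of acyclic objects contains the zero objects,
is closed under isomorphism, shifts, extensions (cones), and retracts (direct
summands). -/
theorem stmt_16 [HasZeroObject A] [HasBinaryBiproducts A] (E : ExactStructure A) :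
    -- closed under isomorphism
    (∀ K L : HomotopyCategory A (ComplexShape.up ℤ),
      K ∈ acyclicClass E → (K ≅ L) → L ∈ acyclicClass E) ∧
    -- contains the zero objects
    (∀ K : HomotopyCategory A (ComplexShape.up ℤ), IsZero K → K ∈ acyclicClass E) ∧
    -- closed under shifts
    (∀ (K : HomotopyCategory A (ComplexShape.up ℤ)) (n : ℤ),
      K ∈ acyclicClass E → K⟦n⟧ ∈ acyclicClass E) ∧
    -- closed under extensions: a triangulated subcategory
    (∀ D : Triangle (HomotopyCategory A (ComplexShape.up ℤ)),
      (D ∈ distTriang (HomotopyCategory A (ComplexShape.up ℤ))) →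
      D.obj₁ ∈ acyclicClass E → D.obj₃ ∈ acyclicClass E →
      D.obj₂ ∈ acyclicClass E) ∧
    -- closed under retracts (direct summands): thickness
    (∀ K L : HomotopyCategory A (ComplexShape.up ℤ),
      K ∈ acyclicClass E →
      (∃ (s : L ⟶ K) (r : K ⟶ L), s ≫ r = 𝟙 L) → L ∈ acyclicClass E) := by
  exact ⟨fun _ _ hK e => ExactStructure.acyclicClass_of_iso hK e,
    fun _ hK => ExactStructure.acyclicClass_of_isZero hK,
    fun _ n hK => ExactStructure.acyclicClass_shift hK n,
    fun _ hD h₁ h₃ => ExactStructure.acyclicClass_of_distTriang hD h₁ h₃,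
    fun _ _ hK ⟨s, r, h⟩ => ExactStructure.acyclicClass_of_retract hK s r h⟩
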